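/- Let a > 0 be real, let k and k′ be positive integers, and for real n > 0 and R ∈ [0,1) define F(n, k, R) = ∫₀^∞ g^{−3/2} exp(−n/(2g)) (g + 1)^{n/2 − k/2 + a} [1 + g(1 − R²)]^{−a − n/2} dg. Let (Rₙ) and (R′ₙ) be sequences in [0,1) such that there exists δ > 0 with 1 − Rₙ² ≥ δ for all n, and such that (1 − Rₙ²)/(1 − R′ₙ²) → q as n → ∞ for some q with 0 ≤ q < 1. Then F(n, k′, R′ₙ)/F(n, k, Rₙ) → 0 as n → ∞ (n ranging over the natural numbers). -/

import Mathlib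

open MeasureTheory Filter Topology

/-- The (unnormalized) marginal posterior of an active set of cardinality `k`:
`F(n, k, R) = ∫₀^∞ g^{-3/2} exp(-n/(2g)) (g+1)^{n/2-k/2+a} [1+g(1-R²)]^{-a-n/2} dg`. -/
noncomputable def postF (a : ℝ) (n : ℝ) (k : ℕ) (R : ℝ) : ℝ :=
  ∫ g in Set.Ioi (0 : ℝ),
    g ^ (-(3 : ℝ) / 2) * Real.exp (-n / (2 * g)) *
      (g + 1) ^ (n / 2 - (k : ℝ) / 2 + a) * (1 + g * (1 - R ^ 2)) ^ (-a - n / 2)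

lemma aux_h_integrable :
    IntegrableOn (fun g : ℝ => g ^ (-(3 : ℝ) / 2) * Real.exp (-1 / (2 * g))) (Set.Ioi 0) := by
  have hm : Measurable (fun g : ℝ => g ^ (-(3 : ℝ) / 2) * Real.exp (-1 / (2 * g))) := by
    fun_prop
  have hsplit : Set.Ioi (0 : ℝ) = Set.Ioc 0 1 ∪ Set.Ioi 1 :=
    (Set.Ioc_union_Ioi_eq_Ioi zero_le_one).symm
  rw [hsplit]
  refine IntegrableOn.union ?_ ?_
  · have hc : IntegrableOn (fun _ : ℝ => (8 : ℝ)) (Set.Ioc (0 : ℝ) 1) := by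
      simp
    refine Integrable.mono' hc hm.aestronglyMeasurable ?_
    refine (ae_restrict_iff' measurableSet_Ioc).2 (Eventually.of_forall fun g hg => ?_)
    obtain ⟨h0, h1⟩ := hg
    rw [Real.norm_of_nonneg (by positivity)]
    have e1 : Real.exp (-1 / (2 * g)) ≤ 8 * g ^ 2 := by
      have hx : 0 ≤ 1 / (2 * g) := by positivity
      have := Real.quadratic_le_exp_of_nonneg hx
      have h2 : (1 / (2 * g)) ^ 2 / 2 ≤ Real.exp (1 / (2 * g)) := by linarith
      have h3 : (-1 / (2 * g)) = -(1 / (2 * g)) := by ring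
      rw [h3, Real.exp_neg]
      have h4 : (8 * g ^ 2) = ((1 / (2 * g)) ^ 2 / 2)⁻¹ := by field_simp; norm_num
      rw [h4]
      exact inv_anti₀ (by positivity) h2
    calc g ^ (-(3 : ℝ) / 2) * Real.exp (-1 / (2 * g))
        ≤ g ^ (-(3 : ℝ) / 2) * (8 * g ^ 2) := by gcongr
      _ = 8 * g ^ ((1 : ℝ) / 2) := by
          rw [← Real.rpow_natCast g 2]
          rw [show g ^ (-(3 : ℝ) / 2) * (8 * g ^ ((2 : ℕ) : ℝ))
            = 8 * (g ^ (-(3 : ℝ) / 2) * g ^ ((2 : ℕ) : ℝ)) by ring, ← Real.rpow_add h0]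
          norm_num
      _ ≤ 8 * 1 := by
          gcongr
          exact Real.rpow_le_one h0.le h1 (by norm_num)
      _ = 8 := by norm_num
  · have hc : IntegrableOn (fun g : ℝ => g ^ (-(3 : ℝ) / 2)) (Set.Ioi (1 : ℝ)) :=
      integrableOn_Ioi_rpow_of_lt (by norm_num) one_pos
    refine Integrable.mono' hc hm.aestronglyMeasurable ?_
    refine (ae_restrict_iff' measurableSet_Ioi).2 (Eventually.of_forall fun g hg => ?_)
    have h0 : (0 : ℝ) < g := lt_trans one_pos hg
    rw [Real.norm_of_nonneg (by positivity)]
    refine mul_le_of_le_one_right (by positivity) (Real.exp_le_one_iff.2 ?_)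
    exact div_nonpos_of_nonpos_of_nonneg (by norm_num) (by positivity)

lemma aux_upper (a n s g : ℝ) (k : ℕ) (ha : 0 < a) (hn : 1 ≤ n) (hs : 0 < s) (hs1 : s ≤ 1)
    (hg : 0 < g) :
    g ^ (-(3 : ℝ) / 2) * Real.exp (-n / (2 * g)) *
      (g + 1) ^ (n / 2 - (k : ℝ) / 2 + a) * (1 + g * s) ^ (-a - n / 2)
    ≤ s ^ (-(n / 2 + a)) * (g ^ (-(3 : ℝ) / 2) * Real.exp (-1 / (2 * g))) := by
  have hD : 0 < 1 + g * s := by positivity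
  have h1 : Real.exp (-n / (2 * g)) ≤ Real.exp (-1 / (2 * g)) := by
    apply Real.exp_le_exp.2
    gcongr
  have h2 : (g + 1) ^ (n / 2 - (k : ℝ) / 2 + a) ≤ (g + 1) ^ (n / 2 + a) := by
    apply Real.rpow_le_rpow_of_exponent_le (by linarith)
    have : (0 : ℝ) ≤ k := Nat.cast_nonneg k
    linarith
  have h3 : (g + 1) ^ (n / 2 + a) ≤ (1 + g * s) ^ (n / 2 + a) * s ^ (-(n / 2 + a)) := by
    rw [Real.rpow_neg hs.le, ← div_eq_mul_inv, ← Real.div_rpow hD.le hs.le]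
    apply Real.rpow_le_rpow (by positivity) _ (by linarith)
    rw [le_div_iff₀ hs]
    nlinarith
  have h4 : (1 + g * s) ^ (n / 2 + a) * (1 + g * s) ^ (-a - n / 2) = 1 := by
    rw [← Real.rpow_add hD]
    ring_nf
    simp
  calc g ^ (-(3 : ℝ) / 2) * Real.exp (-n / (2 * g)) *
      (g + 1) ^ (n / 2 - (k : ℝ) / 2 + a) * (1 + g * s) ^ (-a - n / 2)
      ≤ g ^ (-(3 : ℝ) / 2) * Real.exp (-1 / (2 * g)) *
      ((1 + g * s) ^ (n / 2 + a) * s ^ (-(n / 2 + a))) * (1 + g * s) ^ (-a - n / 2) := by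
        gcongr
        exact h2.trans h3
    _ = s ^ (-(n / 2 + a)) * (g ^ (-(3 : ℝ) / 2) * Real.exp (-1 / (2 * g))) *
        ((1 + g * s) ^ (n / 2 + a) * (1 + g * s) ^ (-a - n / 2)) := by ring
    _ = _ := by rw [h4, mul_one]

lemma aux_integrable (a n s : ℝ) (k : ℕ) (ha : 0 < a) (hn : 1 ≤ n) (hs : 0 < s) (hs1 : s ≤ 1) :
    IntegrableOn (fun g : ℝ => g ^ (-(3 : ℝ) / 2) * Real.exp (-n / (2 * g)) *
      (g + 1) ^ (n / 2 - (k : ℝ) / 2 + a) * (1 + g * s) ^ (-a - n / 2)) (Set.Ioi 0) := by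
  refine Integrable.mono' (aux_h_integrable.const_mul (s ^ (-(n / 2 + a)))) ?_ ?_
  · apply Measurable.aestronglyMeasurable
    fun_prop
  · refine (ae_restrict_iff' measurableSet_Ioi).2 (Eventually.of_forall fun g hg => ?_)
    have h0 : (0 : ℝ) < g := hg
    rw [Real.norm_of_nonneg (by positivity)]
    exact aux_upper a n s g k ha hn hs hs1 h0

lemma aux_lower (a n s δ g : ℝ) (k : ℕ) (ha : 0 < a) (hn : 1 ≤ n) (hδ : 0 < δ) (hs : δ ≤ s)
    (hg : n < g) (hg' : g ≤ n + 1) :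
    s ^ (-(n / 2 + a)) * (((3 * n) ^ (k + 2))⁻¹ * Real.exp (-1 / 2) *
      Real.exp (-((1 / 2 + a) / δ)))
    ≤ g ^ (-(3 : ℝ) / 2) * Real.exp (-n / (2 * g)) *
      (g + 1) ^ (n / 2 - (k : ℝ) / 2 + a) * (1 + g * s) ^ (-a - n / 2) := by
  have hn0 : 0 < n := by linarith
  have hg0 : 0 < g := by linarith
  have hs0 : 0 < s := by linarith
  have hD : 0 < 1 + g * s := by positivity
  have hk0 : (0 : ℝ) ≤ k := Nat.cast_nonneg k
  have he : 0 < n / 2 + a := by positivity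
  have h1 : Real.exp (-1 / 2) ≤ Real.exp (-n / (2 * g)) := by
    apply Real.exp_le_exp.2
    rw [div_le_div_iff₀ (by norm_num) (by positivity)]
    nlinarith
  have h2 : ((3 * n) ^ (k + 2))⁻¹ ≤ g ^ (-(3 : ℝ) / 2) * (g + 1) ^ (-(k : ℝ) / 2) := by
    calc ((3 * n) ^ (k + 2))⁻¹ ≤ ((g + 1) ^ (k + 2))⁻¹ := by
          gcongr
          linarith
      _ = (g + 1) ^ (-((k : ℝ) + 2)) := by
          rw [Real.rpow_neg (by positivity), ← Real.rpow_natCast]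
          push_cast
          rfl
      _ ≤ (g + 1) ^ (-(3 : ℝ) / 2 + -(k : ℝ) / 2) := by
          apply Real.rpow_le_rpow_of_exponent_le (by linarith)
          linarith
      _ = (g + 1) ^ (-(3 : ℝ) / 2) * (g + 1) ^ (-(k : ℝ) / 2) :=
          Real.rpow_add (by linarith) _ _
      _ ≤ _ := by
          gcongr ?_ * _
          exact Real.rpow_le_rpow_of_nonpos hg0 (by linarith) (by norm_num)
  -- (1+gs) ≤ s (g+1) exp(1/(nδ))
  have h3 : 1 + g * s ≤ s * (g + 1) * Real.exp (1 / (n * δ)) := by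
    have hx := Real.add_one_le_exp (1 / (n * δ))
    have h5 : 1 ≤ g * s * (1 / (n * δ)) := by
      rw [mul_one_div, le_div_iff₀ (by positivity), one_mul]
      gcongr
    calc 1 + g * s ≤ g * s * (1 / (n * δ) + 1) := by linarith
      _ ≤ (g * s) * Real.exp (1 / (n * δ)) := by gcongr
      _ ≤ _ := by
        gcongr ?_ * _
        nlinarith
  have h4 : (1 + g * s) ^ (n / 2 + a) ≤
      s ^ (n / 2 + a) * (g + 1) ^ (n / 2 + a) * Real.exp ((1 / 2 + a) / δ) := by
    calc (1 + g * s) ^ (n / 2 + a) ≤ (s * (g + 1) * Real.exp (1 / (n * δ))) ^ (n / 2 + a) :=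
          Real.rpow_le_rpow hD.le h3 he.le
      _ = s ^ (n / 2 + a) * (g + 1) ^ (n / 2 + a) * Real.exp (1 / (n * δ) * (n / 2 + a)) := by
          rw [Real.mul_rpow (by positivity) (by positivity),
            Real.mul_rpow (by positivity) (by positivity), ← Real.exp_mul]
      _ ≤ _ := by
          gcongr
          rw [div_mul_eq_mul_div, div_le_div_iff₀ (by positivity) hδ]
          nlinarith [mul_nonneg (mul_nonneg ha.le hδ.le) (sub_nonneg.2 hn)]
  have h6 : s ^ (-(n / 2 + a)) * Real.exp (-((1 / 2 + a) / δ)) ≤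
      (g + 1) ^ (n / 2 + a) * (1 + g * s) ^ (-a - n / 2) := by
    rw [show -a - n / 2 = -(n / 2 + a) by ring, Real.rpow_neg hD.le, Real.rpow_neg hs0.le,
      Real.exp_neg, ← mul_inv, ← div_eq_mul_inv, inv_eq_one_div,
      div_le_div_iff₀ (by positivity) (by positivity)]
    linarith
  have h7 : (g + 1) ^ (n / 2 - (k : ℝ) / 2 + a) =
      (g + 1) ^ (-(k : ℝ) / 2) * (g + 1) ^ (n / 2 + a) := by
    rw [← Real.rpow_add (by linarith)]
    ring_nf
  rw [h7]
  calc _ = ((3 * n) ^ (k + 2))⁻¹ * Real.exp (-1 / 2) *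
        (s ^ (-(n / 2 + a)) * Real.exp (-((1 / 2 + a) / δ))) := by ring
    _ ≤ (g ^ (-(3 : ℝ) / 2) * (g + 1) ^ (-(k : ℝ) / 2)) * Real.exp (-n / (2 * g)) *
        ((g + 1) ^ (n / 2 + a) * (1 + g * s) ^ (-a - n / 2)) := by gcongr
    _ = _ := by ring

lemma postF_upper (a n R : ℝ) (k : ℕ) (ha : 0 < a) (hn : 1 ≤ n) (hs : 0 < 1 - R ^ 2) :
    postF a n k R ≤ (1 - R ^ 2) ^ (-(n / 2 + a)) *
      ∫ g in Set.Ioi (0 : ℝ), g ^ (-(3 : ℝ) / 2) * Real.exp (-1 / (2 * g)) := by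
  have hs1 : 1 - R ^ 2 ≤ 1 := by nlinarith [sq_nonneg R]
  unfold postF
  rw [← integral_const_mul]
  refine setIntegral_mono_on (aux_integrable a n _ k ha hn hs hs1)
    (aux_h_integrable.const_mul _) measurableSet_Ioi fun g hg => ?_
  exact aux_upper a n _ g k ha hn hs hs1 hg

lemma postF_nonneg (a n R : ℝ) (k : ℕ) (hs : 0 < 1 - R ^ 2) : 0 ≤ postF a n k R := by
  unfold postF
  refine setIntegral_nonneg measurableSet_Ioi fun g hg => ?_
  have h0 : (0 : ℝ) < g := hg
  positivity

lemma postF_lower (a n R δ : ℝ) (k : ℕ) (ha : 0 < a) (hn : 1 ≤ n) (hδ : 0 < δ)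
    (hs : δ ≤ 1 - R ^ 2) :
    (1 - R ^ 2) ^ (-(n / 2 + a)) * (((3 * n) ^ (k + 2))⁻¹ * Real.exp (-1 / 2) *
      Real.exp (-((1 / 2 + a) / δ))) ≤ postF a n k R := by
  have hs0 : 0 < 1 - R ^ 2 := by linarith
  have hs1 : 1 - R ^ 2 ≤ 1 := by nlinarith [sq_nonneg R]
  have hI := aux_integrable a n _ k ha hn hs0 hs1
  have hsub : Set.Ioc n (n + 1) ⊆ Set.Ioi (0 : ℝ) := fun g hg => by
    have := hg.1
    simp only [Set.mem_Ioi]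
    linarith
  unfold postF
  refine le_trans ?_ (setIntegral_mono_set hI ?_ (LE.le.eventuallyLE hsub))
  · have hc := setIntegral_mono_on (μ := volume) (s := Set.Ioc n (n + 1))
      (f := fun _ : ℝ => (1 - R ^ 2) ^ (-(n / 2 + a)) * (((3 * n) ^ (k + 2))⁻¹ *
        Real.exp (-1 / 2) * Real.exp (-((1 / 2 + a) / δ))))
      (integrableOn_const (by simp)) (hI.mono_set hsub) measurableSet_Ioc
      (fun g hg => aux_lower a n _ δ g k ha hn hδ hs hg.1 hg.2)
    simpa using hc
  · refine (ae_restrict_iff' measurableSet_Ioi).2 (Eventually.of_forall fun g hg => ?_)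
    have h0 : (0 : ℝ) < g := hg
    simp only [Pi.zero_apply]
    positivity

/-- Case (i) of Theorem 1 (model selection consistency): if
`(1 - Rₙ²)/(1 - R′ₙ²) → q < 1` and `1 - Rₙ²` is bounded below, then the
posterior ratio `F(n, k′, R′ₙ)/F(n, k, Rₙ)` vanishes. -/
theorem posterior_ratio_tendsto_zero_non_nested
    (a : ℝ) (ha : 0 < a) (k k' : ℕ) (hk : 0 < k) (hk' : 0 < k')
    (R R' : ℕ → ℝ)
    (hR : ∀ n, 0 ≤ R n ∧ R n < 1) (hR' : ∀ n, 0 ≤ R' n ∧ R' n < 1)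
    (hδ : ∃ δ : ℝ, 0 < δ ∧ ∀ n, δ ≤ 1 - R n ^ 2)
    (q : ℝ) (hq0 : 0 ≤ q) (hq1 : q < 1)
    (hq : Tendsto (fun n : ℕ => (1 - R n ^ 2) / (1 - R' n ^ 2)) atTop (𝓝 q)) :
    Tendsto (fun n : ℕ => postF a n k' (R' n) / postF a n k (R n)) atTop (𝓝 0) := by
  obtain ⟨δ, hδ0, hδ⟩ := hδ
  obtain ⟨r, hqr, hr1⟩ := exists_between hq1
  have hr0 : 0 < r := lt_of_le_of_lt hq0 hqr
  have hs' : ∀ n, 0 < 1 - R' n ^ 2 := fun n => by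
    have := hR' n
    nlinarith
  set C1 := ∫ g in Set.Ioi (0 : ℝ), g ^ (-(3 : ℝ) / 2) * Real.exp (-1 / (2 * g)) with hC1
  have hC1n : 0 ≤ C1 := by
    refine setIntegral_nonneg measurableSet_Ioi fun g hg => ?_
    have h0 : (0 : ℝ) < g := hg
    positivity
  set c := Real.exp (-1 / 2) * Real.exp (-((1 / 2 + a) / δ)) with hc
  have hc0 : 0 < c := by positivity
  have hlim : Tendsto (fun n : ℕ => C1 * 3 ^ (k + 2) / c * ((n : ℝ) ^ (k + 2) * (√r) ^ n))
      atTop (𝓝 0) := by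
    have := (tendsto_pow_const_mul_const_pow_of_lt_one (k + 2) (Real.sqrt_nonneg r)
      (by rw [Real.sqrt_lt' one_pos]; simpa using hr1)).const_mul (C1 * 3 ^ (k + 2) / c)
    simpa using this
  refine squeeze_zero' (Eventually.of_forall fun n => div_nonneg
    (postF_nonneg _ _ _ _ (hs' n)) (postF_nonneg _ _ _ _ (hδ0.trans_le (hδ n)))) ?_ hlim
  filter_upwards [hq.eventually_lt_const hqr, eventually_ge_atTop 1] with n hn hn1
  have hn1' : (1 : ℝ) ≤ n := by exact_mod_cast hn1
  have hs0 : 0 < 1 - R n ^ 2 := hδ0.trans_le (hδ n)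
  have hu := postF_upper a n (R' n) k' ha hn1' (hs' n)
  have hl := postF_lower a n (R n) δ k ha hn1' hδ0 (hδ n)
  rw [← hC1] at hu
  rw [mul_assoc (_⁻¹), ← hc] at hl
  have hS := hs' n
  generalize 1 - R' n ^ 2 = s' at *
  generalize 1 - R n ^ 2 = s at *
  have hpow : (s / s') ^ ((n : ℝ) / 2 + a) ≤ (√r) ^ n := by
    have hss : 0 ≤ s / s' := by positivity
    calc (s / s') ^ ((n : ℝ) / 2 + a) ≤ r ^ ((n : ℝ) / 2 + a) :=
          Real.rpow_le_rpow hss hn.le (by positivity)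
      _ ≤ r ^ ((1 / 2 : ℝ) * n) :=
          Real.rpow_le_rpow_of_exponent_ge hr0 hr1.le (by linarith)
      _ = (√r) ^ n := by
          rw [Real.rpow_mul hr0.le, Real.rpow_natCast, Real.sqrt_eq_rpow]
  have hn0 : (0 : ℝ) < n := by linarith
  calc postF a n k' (R' n) / postF a n k (R n)
      ≤ (s' ^ (-((n : ℝ) / 2 + a)) * C1) /
        (s ^ (-((n : ℝ) / 2 + a)) * (((3 * (n : ℝ)) ^ (k + 2))⁻¹ * c)) := by
        apply div_le_div₀ (by positivity) hu (by positivity) hl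
    _ = C1 * 3 ^ (k + 2) / c * ((n : ℝ) ^ (k + 2) * (s / s') ^ ((n : ℝ) / 2 + a)) := by
        rw [Real.rpow_neg hS.le, Real.rpow_neg hs0.le, Real.div_rpow hs0.le hS.le, mul_pow]
        have := Real.rpow_pos_of_pos hS ((n : ℝ) / 2 + a)
        have := Real.rpow_pos_of_pos hs0 ((n : ℝ) / 2 + a)
        field_simp
    _ ≤ _ := by gcongr
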